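/- There is a universal constant C such that for every n ≥ 2, every real Banach space X, every p ∈ [1,∞), and every f : {-1,1}^n → X, one has (E_ε‖f − E_ε f‖_X^p)^{1/p} ≤ (log n + log log n + C) · (E_{ε,δ}‖Σ_{j=1}^n δ_j D_j f(ε)‖_X^p)^{1/p}. -/

import Mathlib

open scoped BigOperators
open Finset

noncomputable section

/-- The ±1 value of a Boolean coordinate. -/
def rad (b : Bool) : ℝ := if b then 1 else -1

/-- Expectation over the uniform measure on the discrete cube `{-1,1}^n`
(points encoded as `Fin n → Bool`). -/
def cubeAvg {n : ℕ} {X : Type*} [AddCommGroup X] [Module ℝ X]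
    (f : (Fin n → Bool) → X) : X :=
  ((2 ^ n : ℝ)⁻¹) • ∑ ε : Fin n → Bool, f ε

/-- Walsh character `w_A(ε) = ∏_{i ∈ A} ε_i`. -/
def walshChar {n : ℕ} (A : Finset (Fin n)) (ε : Fin n → Bool) : ℝ :=
  ∏ i ∈ A, rad (ε i)

/-- Walsh coefficient `f̂(A) = E_ε [f(ε) w_A(ε)]`. -/
def wcoef {n : ℕ} {X : Type*} [AddCommGroup X] [Module ℝ X]
    (f : (Fin n → Bool) → X) (A : Finset (Fin n)) : X :=
  cubeAvg (fun ε => walshChar A ε • f ε)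

/-- Flip the `j`-th coordinate. -/
def flipCoord {n : ℕ} (j : Fin n) (ε : Fin n → Bool) : Fin n → Bool :=
  Function.update ε j (!(ε j))

/-- Discrete derivative `D_j f(ε) = (f(ε) - f(σ_j ε))/2`. -/
def Dop {n : ℕ} {X : Type*} [AddCommGroup X] [Module ℝ X]
    (j : Fin n) (f : (Fin n → Bool) → X) : (Fin n → Bool) → X :=
  fun ε => (2 : ℝ)⁻¹ • (f ε - f (flipCoord j ε))

/-- Heat semigroup `P_t f = Σ_A e^{-t|A|} f̂(A) w_A`. -/
def heatOp {n : ℕ} {X : Type*} [AddCommGroup X] [Module ℝ X]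
    (t : ℝ) (f : (Fin n → Bool) → X) : (Fin n → Bool) → X :=
  fun ε => ∑ A : Finset (Fin n), (Real.exp (-t * A.card) * walshChar A ε) • wcoef f A

/-- Fractional power of the Laplacian on mean-zero parts:
`Δ^a f = Σ_{A ≠ ∅} |A|^a f̂(A) w_A`. -/
def lapPow {n : ℕ} {X : Type*} [AddCommGroup X] [Module ℝ X]
    (a : ℝ) (f : (Fin n → Bool) → X) : (Fin n → Bool) → X :=
  fun ε => ∑ A ∈ Finset.univ.filter (fun A : Finset (Fin n) => A ≠ ∅),
    (((A.card : ℝ)) ^ a * walshChar A ε) • wcoef f A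

/-- `X` has cotype `q` with constant `K`. -/
def HasCotypeConst (X : Type*) [NormedAddCommGroup X] [NormedSpace ℝ X] (q K : ℝ) : Prop :=
  ∀ m : ℕ, ∀ x : Fin m → X,
    (∑ j, ‖x j‖ ^ q) ^ (1 / q) ≤
      K * (cubeAvg (fun δ : Fin m → Bool => ‖∑ j, rad (δ j) • x j‖ ^ (2 : ℝ))) ^ (1 / 2 : ℝ)

/-- `X` has type `s` with constant `T`. -/
def HasTypeConst (X : Type*) [NormedAddCommGroup X] [NormedSpace ℝ X] (s T : ℝ) : Prop :=
  ∀ m : ℕ, ∀ x : Fin m → X,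
    (cubeAvg (fun δ : Fin m → Bool => ‖∑ j, rad (δ j) • x j‖ ^ (2 : ℝ))) ^ (1 / 2 : ℝ) ≤
      T * (∑ j, ‖x j‖ ^ s) ^ (1 / s)

lemma rad_true : rad true = 1 := rfl

lemma rad_false : rad false = -1 := rfl

lemma sum_prod_bool {n : ℕ} (F : Fin n → Bool → ℝ) :
    ∑ η : Fin n → Bool, ∏ i, F i (η i) = ∏ i, (F i true + F i false) := by
  have h := Finset.prod_univ_sum (fun _ : Fin n => (Finset.univ : Finset Bool)) F
  simp only [Fintype.piFinset_univ] at h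
  rw [← h]
  simp

/-- The noise kernel. -/
def Kn {n : ℕ} (a : ℝ) (ε η : Fin n → Bool) : ℝ :=
  ∏ i, (1 + a * (rad (ε i) * rad (η i))) / 2

/-- One coordinate of the coupling. -/
def kk (a : ℝ) (e y d : Bool) : ℝ :=
  ((1 - a) * ((1 + rad e * rad y * rad d) / 2) + a * ((1 + rad e * rad y) / 2)) / 2

/-- The coupling kernel. -/
def Kd {n : ℕ} (a : ℝ) (ε : Fin n → Bool) (z : (Fin n → Bool) × (Fin n → Bool)) : ℝ :=
  ∏ i, kk a (ε i) (z.1 i) (z.2 i)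

lemma Kn_row {n : ℕ} (a : ℝ) (ε : Fin n → Bool) : ∑ η, Kn a ε η = 1 := by
  unfold Kn
  rw [sum_prod_bool (fun i b => (1 + a * (rad (ε i) * rad b)) / 2)]
  apply Finset.prod_eq_one
  intro i _
  simp only [rad_true, rad_false]; ring

lemma Kn_comm {n : ℕ} (a : ℝ) (ε η : Fin n → Bool) : Kn a ε η = Kn a η ε := by
  unfold Kn
  exact Finset.prod_congr rfl fun i _ => by ring

lemma Kn_abs_row {n : ℕ} (a : ℝ) (ha : 1 ≤ a) (ε : Fin n → Bool) :
    ∑ η, |Kn a ε η| = a ^ n := by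
  unfold Kn
  simp_rw [Finset.abs_prod]
  rw [sum_prod_bool (fun i b => |(1 + a * (rad (ε i) * rad b)) / 2|)]
  have h1 : |(1 + a) / 2| = (1 + a) / 2 := abs_of_nonneg (by linarith)
  have h2 : |(1 + -a) / 2| = (a - 1) / 2 := by rw [abs_of_nonpos (by linarith)]; ring
  rw [Finset.prod_congr rfl (g := fun _ => a)]
  · simp
  intro i _
  cases ε i <;> simp [rad, h1, h2] <;> ring

lemma Kn_zero {n : ℕ} (ε η : Fin n → Bool) : Kn 0 ε η = (2 ^ n : ℝ)⁻¹ := by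
  simp [Kn]

lemma Kn_one {n : ℕ} (ε η : Fin n → Bool) : Kn 1 ε η = if ε = η then 1 else 0 := by
  unfold Kn
  split_ifs with h
  · subst h
    apply Finset.prod_eq_one
    intro i _
    cases ε i <;> norm_num [rad]
  · obtain ⟨i, hi⟩ := Function.ne_iff.1 h
    apply Finset.prod_eq_zero (Finset.mem_univ i)
    revert hi
    cases ε i <;> cases η i <;> norm_num [rad]

lemma Kn_mul {n : ℕ} (a b : ℝ) (ε ζ : Fin n → Bool) :
    ∑ η, Kn a ε η * Kn b η ζ = Kn (a * b) ε ζ := by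
  unfold Kn
  simp_rw [← Finset.prod_mul_distrib]
  rw [sum_prod_bool (fun i c => (1 + a * (rad (ε i) * rad c)) / 2 *
    ((1 + b * (rad c * rad (ζ i))) / 2))]
  apply Finset.prod_congr rfl
  intro i _
  simp only [rad_true, rad_false]; ring

lemma kk_nonneg (a : ℝ) (h0 : 0 ≤ a) (h1 : a ≤ 1) (e y d : Bool) : 0 ≤ kk a e y d := by
  cases e <;> cases y <;> cases d <;> simp [kk, rad] <;> linarith

lemma Kd_nonneg {n : ℕ} (a : ℝ) (h0 : 0 ≤ a) (h1 : a ≤ 1) (ε : Fin n → Bool) (z) :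
    0 ≤ Kd a ε z := Finset.prod_nonneg fun _ _ => kk_nonneg a h0 h1 _ _ _

lemma Kd_row {n : ℕ} (a : ℝ) (ε : Fin n → Bool) : ∑ z, Kd a ε z = 1 := by
  rw [Fintype.sum_prod_type, ← Kn_row a ε]
  apply Finset.sum_congr rfl
  intro y _
  unfold Kd Kn
  simp only
  rw [sum_prod_bool (fun i b => kk a (ε i) (y i) b)]
  apply Finset.prod_congr rfl
  intro i _
  simp only [kk, rad_true, rad_false]; ring

lemma Kd_col {n : ℕ} (a : ℝ) (z : (Fin n → Bool) × (Fin n → Bool)) :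
    ∑ ε, Kd a ε z = (2 ^ n : ℝ)⁻¹ := by
  unfold Kd
  rw [sum_prod_bool (fun i b => kk a b (z.1 i) (z.2 i))]
  rw [Finset.prod_congr rfl (g := fun _ => (2 : ℝ)⁻¹)]
  · simp
  intro i _
  simp only [kk, rad_true, rad_false]; ring

/-- Derivative weight. -/
def wj {n : ℕ} (a : ℝ) (j : Fin n) (ε y : Fin n → Bool) : ℝ :=
  (∏ i ∈ Finset.univ.erase j, (1 + a * (rad (ε i) * rad (y i))) / 2) *
    (rad (ε j) * rad (y j) / 2)

lemma Kd_delta {n : ℕ} (a : ℝ) (j : Fin n) (ε y : Fin n → Bool) :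
    ∑ δ, Kd a ε (y, δ) * rad (δ j) = (1 - a) * wj a j ε y := by
  have h : ∀ δ : Fin n → Bool, Kd a ε (y, δ) * rad (δ j) =
      ∏ i, (kk a (ε i) (y i) (δ i) * if i = j then rad (δ i) else 1) := by
    intro δ
    rw [Finset.prod_mul_distrib, Finset.prod_ite_eq' Finset.univ j]
    simp [Kd]
  simp_rw [h]
  rw [sum_prod_bool (fun i b => kk a (ε i) (y i) b * if i = j then rad b else 1)]
  rw [← Finset.mul_prod_erase _ _ (Finset.mem_univ j)]
  have h2 : ∏ i ∈ Finset.univ.erase j, ((kk a (ε i) (y i) true * if i = j then rad true else 1) +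
      (kk a (ε i) (y i) false * if i = j then rad false else 1)) =
      ∏ i ∈ Finset.univ.erase j, (1 + a * (rad (ε i) * rad (y i))) / 2 := by
    apply Finset.prod_congr rfl
    intro i hi
    simp only [Finset.mem_erase, Finset.mem_univ, and_true] at hi
    simp only [hi, kk, rad_true, rad_false, if_false]; ring
  rw [h2]
  simp only [wj, kk, rad_true, rad_false, if_true]; ring

lemma flipCoord_flipCoord {n : ℕ} (j : Fin n) (y : Fin n → Bool) : flipCoord j (flipCoord j y) = y := by
  simp [flipCoord]

lemma wj_flip {n : ℕ} (a : ℝ) (j : Fin n) (ε y : Fin n → Bool) :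
    wj a j ε (flipCoord j y) = - wj a j ε y := by
  unfold wj
  have : ∏ i ∈ Finset.univ.erase j, (1 + a * (rad (ε i) * rad (flipCoord j y i))) / 2 =
      ∏ i ∈ Finset.univ.erase j, (1 + a * (rad (ε i) * rad (y i))) / 2 := by
    apply Finset.prod_congr rfl
    intro i hi
    simp only [Finset.mem_erase, Finset.mem_univ, and_true] at hi
    simp [flipCoord, hi]
  rw [this]
  have h2 : rad (flipCoord j y j) = - rad (y j) := by
    simp only [flipCoord, Function.update_self]
    cases y j <;> simp [rad]
  rw [h2]; ring

section
variable {X : Type*} [NormedAddCommGroup X] [NormedSpace ℝ X]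

lemma wj_Dop {n : ℕ} (a : ℝ) (j : Fin n) (ε : Fin n → Bool) (f : (Fin n → Bool) → X) :
    ∑ y, wj a j ε y • Dop j f y = ∑ y, wj a j ε y • f y := by
  have h : ∑ y, wj a j ε y • f (flipCoord j y) = - ∑ y, wj a j ε y • f y := by
    rw [← Finset.sum_neg_distrib]
    apply Fintype.sum_equiv (Function.Involutive.toPerm (flipCoord j) (flipCoord_flipCoord j))
    intro y
    change wj a j ε y • f (flipCoord j y) = -(wj a j ε (flipCoord j y) • f (flipCoord j y))
    rw [wj_flip, neg_smul, neg_neg]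
  unfold Dop
  simp_rw [smul_comm _ (2 : ℝ)⁻¹, ← Finset.smul_sum, smul_sub, Finset.sum_sub_distrib, h]
  rw [sub_neg_eq_add, ← two_smul ℝ, smul_smul]
  norm_num

/-- Noise operator. -/
def Tn {n : ℕ} (a : ℝ) (f : (Fin n → Bool) → X) (ε : Fin n → Bool) : X :=
  ∑ η, Kn a ε η • f η

/-- Derivative of the noise operator. -/
def Tn' {n : ℕ} (a : ℝ) (f : (Fin n → Bool) → X) (ε : Fin n → Bool) : X :=
  (1 - a)⁻¹ • ∑ z : (Fin n → Bool) × (Fin n → Bool),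
    Kd a ε z • ∑ j, rad (z.2 j) • Dop j f z.1

lemma Kn_deriv {n : ℕ} (a : ℝ) (ε η : Fin n → Bool) :
    HasDerivAt (fun a => Kn a ε η) (∑ j, wj a j ε η) a := by
  unfold Kn wj
  have := HasDerivAt.fun_finsetProd (u := (Finset.univ : Finset (Fin n))) (x := a)
    (f := fun i a => (1 + a * (rad (ε i) * rad (η i))) / 2)
    (f' := fun i => rad (ε i) * rad (η i) / 2) (by
      intro i _
      have := (((hasDerivAt_id a).mul_const (rad (ε i) * rad (η i))).const_add 1).div_const 2
      simpa using this)
  simpa only [smul_eq_mul] using this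

lemma Tn'_eq {n : ℕ} (a : ℝ) (ha : a < 1) (f : (Fin n → Bool) → X) (ε : Fin n → Bool) :
    Tn' a f ε = ∑ η, (∑ j, wj a j ε η) • f η := by
  have h0 : (1 - a) ≠ 0 := by linarith
  simp_rw [Finset.sum_smul]
  rw [Finset.sum_comm]
  unfold Tn'
  simp_rw [Finset.smul_sum]
  rw [Finset.sum_comm]
  apply Finset.sum_congr rfl
  intro j _
  rw [← wj_Dop, Fintype.sum_prod_type]
  apply Finset.sum_congr rfl
  intro y _
  simp_rw [smul_smul]
  rw [← Finset.sum_smul, ← Finset.mul_sum, Kd_delta, inv_mul_cancel_left₀ h0]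

lemma Tn_deriv {n : ℕ} (a : ℝ) (ha : a < 1) (f : (Fin n → Bool) → X) (ε : Fin n → Bool) :
    HasDerivAt (fun a => Tn a f ε) (Tn' a f ε) a := by
  rw [Tn'_eq a ha]
  unfold Tn
  exact HasDerivAt.fun_sum fun η _ => (Kn_deriv a ε η).smul_const (f η)

lemma schur {A B : Type*} [Fintype A] [Fintype B] (k : A → B → ℝ) (s p : ℝ) (hp : 1 ≤ p)
    (hr : ∀ a, ∑ b, |k a b| = 1) (hc : ∀ b, ∑ a, |k a b| = s) (g : B → X) :
    ∑ a, ‖∑ b, k a b • g b‖ ^ p ≤ s * ∑ b, ‖g b‖ ^ p := by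
  calc ∑ a, ‖∑ b, k a b • g b‖ ^ p ≤ ∑ a, ∑ b, |k a b| * ‖g b‖ ^ p := by
        apply Finset.sum_le_sum
        intro a _
        refine le_trans ?_ (Real.rpow_arith_mean_le_arith_mean_rpow Finset.univ
          (fun b => |k a b|) (fun b => ‖g b‖) (fun _ _ => abs_nonneg _) (hr a)
          (fun _ _ => norm_nonneg _) hp)
        apply Real.rpow_le_rpow (norm_nonneg _) _ (by linarith)
        refine (norm_sum_le _ _).trans_eq ?_
        simp [norm_smul]
    _ = s * ∑ b, ‖g b‖ ^ p := by
        rw [Finset.sum_comm, Finset.mul_sum]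
        apply Finset.sum_congr rfl
        intro b _
        rw [← Finset.sum_mul, hc]

/-- The unnormalised `L^p` norm. -/
def Np {A : Type*} [Fintype A] (p : ℝ) (g : A → X) : ℝ := (∑ a, ‖g a‖ ^ p) ^ (1 / p)

lemma Np_smul {A : Type*} [Fintype A] (p : ℝ) (hp : 1 ≤ p) (c : ℝ) (g : A → X) :
    Np p (fun a => c • g a) = |c| * Np p g := by
  unfold Np
  simp_rw [norm_smul, Real.mul_rpow (norm_nonneg _) (norm_nonneg _)]
  rw [← Finset.mul_sum, Real.mul_rpow (by positivity) (by positivity), ← Real.rpow_mul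
    (norm_nonneg _), mul_one_div_cancel (by linarith), Real.rpow_one, Real.norm_eq_abs]

/-- The right-hand side, unnormalised in `ε`. -/
def Rp {n : ℕ} (p : ℝ) (f : (Fin n → Bool) → X) : ℝ :=
  ((2 ^ n : ℝ)⁻¹ * ∑ z : (Fin n → Bool) × (Fin n → Bool),
    ‖∑ j, rad (z.2 j) • Dop j f z.1‖ ^ p) ^ (1 / p)

lemma Tn'_bound {n : ℕ} (a p : ℝ) (hp : 1 ≤ p) (h0 : 0 ≤ a) (h1 : a < 1)
    (f : (Fin n → Bool) → X) : Np p (Tn' a f) ≤ (1 - a)⁻¹ * Rp p f := by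
  have : Np p (Tn' a f) = |(1 - a)⁻¹| * Np p (fun ε => ∑ z : (Fin n → Bool) × (Fin n → Bool),
    Kd a ε z • ∑ j, rad (z.2 j) • Dop j f z.1) := Np_smul p hp _ _
  rw [this, abs_of_nonneg (inv_nonneg.2 (by linarith))]
  apply mul_le_mul_of_nonneg_left _ (inv_nonneg.2 (by linarith))
  unfold Np Rp
  apply Real.rpow_le_rpow (Finset.sum_nonneg fun _ _ => by positivity) _ (by positivity)
  have habs : ∀ ε : Fin n → Bool, ∀ z, |Kd a ε z| = Kd a ε z :=
    fun ε z => abs_of_nonneg (Kd_nonneg a h0 h1.le ε z)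
  exact schur (Kd a) _ p hp (fun ε => by simp_rw [habs]; exact Kd_row a ε)
    (fun z => by simp_rw [habs]; exact Kd_col a z) (fun z => ∑ j, rad (z.2 j) • Dop j f z.1)

lemma Tn_zero {n : ℕ} (f : (Fin n → Bool) → X) (ε) : Tn 0 f ε = cubeAvg f := by
  simp [Tn, Kn_zero, cubeAvg, Finset.smul_sum]

lemma Tn_bound {n : ℕ} (r p : ℝ) (hp : 1 ≤ p) (h0 : 0 ≤ r) (h1 : r < 1)
    (f : (Fin n → Bool) → X) :
    Np p (fun ε => Tn r f ε - cubeAvg f) ≤ -Real.log (1 - r) * Rp p f := by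
  have hq : (ENNReal.ofReal p).toReal = p := ENNReal.toReal_ofReal (by linarith)
  have : Fact (1 ≤ ENNReal.ofReal p) := ⟨by simpa using hp⟩
  have hN : ∀ g : (Fin n → Bool) → X,
      ‖(WithLp.toLp (ENNReal.ofReal p) g : PiLp (ENNReal.ofReal p) fun _ => X)‖ = Np p g := by
    intro g
    rw [PiLp.norm_eq_sum (by rw [hq]; linarith), hq]; rfl
  let L := (PiLp.continuousLinearEquiv (ENNReal.ofReal p) ℝ
    (fun _ : Fin n → Bool => X)).symm.toContinuousLinearMap
  have hL : ∀ g, ‖L g‖ = Np p g := hN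
  have hd : ∀ a < 1, HasDerivAt (fun a => L (fun ε => Tn a f ε - cubeAvg f)) (L (Tn' a f)) a := by
    intro a ha
    apply L.hasFDerivAt.comp_hasDerivAt
    rw [hasDerivAt_pi]
    intro ε
    exact (Tn_deriv a ha f ε).sub_const _
  have hB : ∀ a < 1, HasDerivAt (fun a => -Real.log (1 - a) * Rp p f)
      ((1 - a)⁻¹ * Rp p f) a := by
    intro a ha
    have := (((hasDerivAt_id a).const_sub 1).log (by simp; linarith)).neg.mul_const (Rp p f)
    exact this.congr_deriv (by simp [neg_div])
  rw [← hL]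
  refine image_norm_le_of_norm_deriv_right_le_deriv_boundary' (a := 0) (b := r)
    (f := fun a => L (fun ε => Tn a f ε - cubeAvg f)) (f' := fun a => L (Tn' a f))
    (B := fun a => -Real.log (1 - a) * Rp p f) (B' := fun a => (1 - a)⁻¹ * Rp p f)
    ?_ ?_ ?_ ?_ ?_ ?_ ⟨h0, le_rfl⟩
  · exact fun x hx => (hd x (hx.2.trans_lt h1)).continuousAt.continuousWithinAt
  · exact fun x hx => (hd x (hx.2.trans h1)).hasDerivWithinAt
  · simp only [Tn_zero, sub_self]
    have : (fun _ : Fin n → Bool => (0 : X)) = 0 := rfl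
    simp [this]
  · exact fun x hx => (hB x (hx.2.trans_lt h1)).continuousAt.continuousWithinAt
  · exact fun x hx => (hB x (hx.2.trans h1)).hasDerivWithinAt
  · intro x hx
    rw [hL]
    exact Tn'_bound x p hp hx.1 (hx.2.trans h1) f

lemma inverse_bound {n : ℕ} (r p : ℝ) (hp : 1 ≤ p) (h0 : 0 < r) (h1 : r < 1)
    (f : (Fin n → Bool) → X) :
    Np p (fun ε => f ε - cubeAvg f) ≤ (r ^ n)⁻¹ * Np p (fun ε => Tn r f ε - cubeAvg f) := by
  have key : ∀ ε, f ε - cubeAvg f = (r ^ n)⁻¹ • ∑ η, (r ^ n * Kn r⁻¹ ε η) •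
      (Tn r f η - cubeAvg f) := by
    intro ε
    simp_rw [mul_smul, ← Finset.smul_sum]
    rw [smul_smul, inv_mul_cancel₀ (by positivity), one_smul]
    simp_rw [smul_sub]
    rw [Finset.sum_sub_distrib, ← Finset.sum_smul, Kn_row, one_smul]
    congr 1
    unfold Tn
    simp_rw [Finset.smul_sum, smul_smul]
    rw [Finset.sum_comm]
    simp_rw [← Finset.sum_smul, Kn_mul, inv_mul_cancel₀ h0.ne', Kn_one]
    simp
  have hrow : ∀ ε : Fin n → Bool, ∑ η, |r ^ n * Kn r⁻¹ ε η| = 1 := by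
    intro ε
    simp_rw [abs_mul]
    rw [← Finset.mul_sum, Kn_abs_row _ ((one_le_inv₀ h0).2 h1.le), abs_of_nonneg (by positivity),
      inv_pow, mul_inv_cancel₀ (by positivity)]
  have := schur (fun ε η => r ^ n * Kn r⁻¹ ε η) 1 p hp hrow
    (fun η => by
      rw [← hrow η]
      exact Finset.sum_congr rfl fun ε _ => by rw [Kn_comm]) (fun ε => Tn r f ε - cubeAvg f)
  rw [show (fun ε => f ε - cubeAvg f) = _ from funext key, Np_smul p hp, abs_of_nonneg (by positivity)]
  apply mul_le_mul_of_nonneg_left _ (by positivity)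
  unfold Np
  apply Real.rpow_le_rpow (Finset.sum_nonneg fun _ _ => by positivity) _ (by positivity)
  simpa using this

end

lemma numeric (n : ℕ) (hn : 2 ≤ n) : ∃ r : ℝ, 0 < r ∧ r < 1 ∧
    (r ^ n)⁻¹ * -Real.log (1 - r) ≤ Real.log n + Real.log (Real.log n) + 6 := by
  have hn' : (2 : ℝ) ≤ n := by exact_mod_cast hn
  set L := Real.log n with hL
  have hL0 : (1 : ℝ) / 2 < L := by
    have := Real.log_le_log (by norm_num) hn'
    have := Real.log_two_gt_d9
    linarith
  have hm : 0 < (n : ℝ) * (L + 2) := by positivity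
  have hm1 : 1 < (n : ℝ) * (L + 2) := by nlinarith
  refine ⟨1 - (n * (L + 2))⁻¹, ?_, ?_, ?_⟩
  · have := inv_lt_one_of_one_lt₀ hm1
    linarith
  · have := inv_pos.2 hm
    linarith
  have hlog : -Real.log (1 - (1 - ((n : ℝ) * (L + 2))⁻¹)) = L + Real.log (L + 2) := by
    rw [sub_sub_cancel, Real.log_inv, neg_neg, Real.log_mul (by positivity) (by positivity)]
  rw [hlog]
  have hb : (L + 1) / (L + 2) ≤ (1 - ((n : ℝ) * (L + 2))⁻¹) ^ n := by
    have h := one_add_mul_le_pow (a := -((n : ℝ) * (L + 2))⁻¹) (by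
      have := inv_lt_one_of_one_lt₀ hm1
      linarith) n
    rw [← sub_eq_add_neg] at h
    refine le_trans (le_of_eq ?_) h
    field_simp
    ring
  have hi : ((1 - ((n : ℝ) * (L + 2))⁻¹) ^ n)⁻¹ ≤ (L + 2) / (L + 1) := by
    rw [← inv_div]
    exact inv_anti₀ (by positivity) hb
  have hl0 : 0 ≤ Real.log (L + 2) := Real.log_nonneg (by linarith)
  have hl1 : Real.log (L + 2) ≤ L + 1 := by
    have := Real.log_le_sub_one_of_pos (show 0 < L + 2 by linarith)
    linarith
  have hl2 : Real.log (L + 2) ≤ Real.log L + 4 := by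
    have h1 : Real.log (L + 2) = Real.log L + Real.log (1 + 2 / L) := by
      rw [← Real.log_mul (by positivity) (by positivity)]
      congr 1
      field_simp
    have h2 := Real.log_le_sub_one_of_pos (show 0 < 1 + 2 / L by positivity)
    have h3 : 2 / L ≤ 4 := by rw [div_le_iff₀ (by linarith)]; linarith
    linarith
  calc _ ≤ (L + 2) / (L + 1) * (L + Real.log (L + 2)) :=
        mul_le_mul_of_nonneg_right hi (by linarith)
    _ ≤ L + Real.log (L + 2) + 2 := by
        rw [div_mul_eq_mul_div, div_le_iff₀ (by linarith)]
        nlinarith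
    _ ≤ _ := by linarith

/-- Pisier's inequality with constant `log n + log log n + C` for an
arbitrary Banach space. -/
theorem pisier_loglog.{u} :
    ∃ C : ℝ, ∀ (n : ℕ), 2 ≤ n →
      ∀ (X : Type u) [NormedAddCommGroup X] [NormedSpace ℝ X] [CompleteSpace X]
        (p : ℝ), 1 ≤ p →
      ∀ f : (Fin n → Bool) → X,
        (cubeAvg (fun ε => ‖f ε - cubeAvg f‖ ^ p)) ^ (1 / p) ≤
          (Real.log n + Real.log (Real.log n) + C) *
            (cubeAvg (fun ε => cubeAvg (fun δ : Fin n → Bool =>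
              ‖∑ j, rad (δ j) • Dop j f ε‖ ^ p))) ^ (1 / p) := by
  refine ⟨6, ?_⟩
  intro n hn X _ _ _ p hp f
  obtain ⟨r, h0, h1, hr⟩ := numeric n hn
  have hR : 0 ≤ Rp p f := by unfold Rp; positivity
  have main : Np p (fun ε => f ε - cubeAvg f) ≤
      (Real.log n + Real.log (Real.log n) + 6) * Rp p f := by
    refine (inverse_bound r p hp h0 h1 f).trans ?_
    refine (mul_le_mul_of_nonneg_left (Tn_bound r p hp h0.le h1 f) (by positivity)).trans ?_
    rw [← mul_assoc]
    exact mul_le_mul_of_nonneg_right hr hR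
  have e1 : (cubeAvg (fun ε => ‖f ε - cubeAvg f‖ ^ p)) ^ (1 / p) =
      ((2 ^ n : ℝ)⁻¹) ^ (1 / p) * Np p (fun ε => f ε - cubeAvg f) := by
    unfold Np
    rw [← Real.mul_rpow (by positivity) (Finset.sum_nonneg fun _ _ => by positivity)]
    rfl
  have e2 : (cubeAvg (fun ε => cubeAvg (fun δ : Fin n → Bool =>
      ‖∑ j, rad (δ j) • Dop j f ε‖ ^ p))) ^ (1 / p) =
      ((2 ^ n : ℝ)⁻¹) ^ (1 / p) * Rp p f := by
    unfold Rp
    rw [← Real.mul_rpow (by positivity) (by positivity)]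
    congr 1
    simp only [cubeAvg, smul_eq_mul]
    rw [Fintype.sum_prod_type, Finset.mul_sum]
    simp only [Finset.mul_sum]
  rw [e1, e2, mul_left_comm]
  exact mul_le_mul_of_nonneg_left main (by positivity)

end
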